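/- Let d ≥ 2. For probability measures p, q, tv(p, q) denotes their total variation distance. There exists a constant C_d > 0 depending only on d such that for every integer k ≥ 1 and every (t, u) ∈ T × N, if (t', u') is drawn from the uniform distribution on T × N, then P( tv( G(1/k, t, u), G(1/k, t', u') ) ≤ 1/400 ) ≤ C_d / k^d. Consequently, r_k := sup_{(t,u) ∈ T×N} P_{(t',u') uniform}( tv(G(1/k,t,u), G(1/k,t',u')) ≤ 1/400 ) = O(1/k^d) → 0 as k → ∞. -/

import Mathlib

open MeasureTheory Real
open scoped RealInnerProductSpace ENNReal

namespace GaussLB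

noncomputable section

/-- Euclidean space `ℝ^d`. -/
abbrev Euc (d : ℕ) := EuclideanSpace ℝ (Fin d)

/-- The last coordinate index of `Fin d`. -/
def lastIdx (d : ℕ) [NeZero d] : Fin d := ⟨d - 1, Nat.sub_lt (NeZero.pos d) one_pos⟩

/-- The last standard basis vector `e_d` of `ℝ^d`. -/
def eLast (d : ℕ) [NeZero d] : Euc d := EuclideanSpace.single (lastIdx d) 1

/-- The disk `T = {(t,0) : t ∈ ℝ^{d−1}, ‖t‖ ≤ 1/2}`. -/
def diskT (d : ℕ) [NeZero d] : Set (Euc d) :=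
  {x | x (lastIdx d) = 0 ∧ ‖x‖ ≤ 1/2}

/-- The cylinder `C = {(t,λ) : t ∈ ℝ^{d−1}, ‖t‖ ≤ 1/2, λ ∈ [1,2]}`. -/
def cylC (d : ℕ) [NeZero d] : Set (Euc d) :=
  {x | x (lastIdx d) ∈ Set.Icc (1:ℝ) 2 ∧ ‖x - x (lastIdx d) • eLast d‖ ≤ 1/2}

/-- The spherical region `N = {u : ‖u‖ = 1, |u·e_d| ≤ √3/2}`. -/
def capN (d : ℕ) [NeZero d] : Set (Euc d) :=
  {u | ‖u‖ = 1 ∧ |⟪u, eLast d⟫| ≤ Real.sqrt 3 / 2}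

/-- The Lebesgue density of the Gaussian `G(σ,t,u) = N(t, I_d − (1−σ²)·u uᵀ)`:
since `det Σ = σ²` and `Σ⁻¹ = I_d + (σ⁻² − 1)·u uᵀ`, it equals
`(2π)^{−d/2} σ⁻¹ exp(−(‖x−t‖² + (σ⁻²−1)⟪u, x−t⟫²)/2)`. -/
def gdens (d : ℕ) (σ : ℝ) (t u : Euc d) (x : Euc d) : ℝ :=
  (2 * π) ^ (-(d:ℝ)/2) * σ⁻¹ *
    Real.exp (-(‖x - t‖^2 + ((σ^2)⁻¹ - 1) * ⟪u, x - t⟫^2) / 2)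

/-- The Gaussian measure `G(σ,t,u) = N(t, I_d − (1−σ²)·u uᵀ)` on `ℝ^d`. -/
def gaussTU (d : ℕ) (σ : ℝ) (t u : Euc d) : Measure (Euc d) :=
  volume.withDensity fun x => ENNReal.ofReal (gdens d σ t u x)

/-- Normalization of a measure to a probability measure. -/
def normalize {Z : Type*} [MeasurableSpace Z] (μ : Measure Z) : Measure Z :=
  (μ Set.univ)⁻¹ • μ

/-- The embedding `ℝ^{d−1} → ℝ^d` appending `0` as the last coordinate. -/
def emb (d : ℕ) : Euc (d-1) → Euc d := fun x =>
  (EuclideanSpace.equiv (Fin d) ℝ).symm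
    (fun i => if h : (i : ℕ) < d - 1 then x ⟨i, h⟩ else 0)

/-- The uniform distribution on the disk `T`: the normalized `(d−1)`-dimensional
Lebesgue measure on the disk of radius `1/2`, embedded into the hyperplane of `ℝ^d`
spanned by the first `d−1` coordinates. -/
def uniformT (d : ℕ) : Measure (Euc d) :=
  normalize ((volume.restrict {x : Euc (d-1) | ‖x‖ ≤ 1/2}).map (emb d))

/-- The uniform distribution on the spherical region `N`: the normalized cone
(surface) measure of `N`. -/
def uniformN (d : ℕ) [NeZero d] : Measure (Euc d) :=
  normalize ((volume.restrict
      {x : Euc d | 0 < ‖x‖ ∧ ‖x‖ ≤ 1 ∧ ‖x‖⁻¹ • x ∈ capN d}).map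
    (fun x => ‖x‖⁻¹ • x))

/-- The uniform distribution on `T × N`. -/
def uniformTN (d : ℕ) [NeZero d] : Measure (Euc d × Euc d) :=
  (uniformT d).prod (uniformN d)

/-- Total variation distance between two measures. -/
def tv {Z : Type*} [MeasurableSpace Z] (p q : Measure Z) : ℝ :=
  ⨆ B : {s : Set Z // MeasurableSet s}, |(p B).toReal - (q B).toReal|

end

open ProbabilityTheory

lemma std_eq (d : ℕ) : gaussTU d 1 0 0 = stdGaussian (Euc d) := by
  have hint : Integrable (fun x : Euc d => gdens d 1 0 0 x) := by
    have := (GaussianFourier.integrable_cexp_neg_mul_sq_norm_add (V := Euc d) (b := (1/2:ℂ))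
      (by norm_num) 0 0).norm.const_mul ((2 * π) ^ (-(d:ℝ)/2))
    refine this.congr (Filter.Eventually.of_forall fun x => ?_)
    simp only [gdens, Complex.norm_exp]
    have : (-(1 / 2:ℂ) * (‖x‖:ℂ) ^ 2 + 0 * ((⟪(0:Euc d), x⟫ : ℝ):ℂ)) = ((-‖x‖^2/2 : ℝ) : ℂ) := by
      push_cast; ring
    rw [this, Complex.ofReal_re]
    simp
  have hnn : ∀ x, 0 ≤ gdens d 1 0 0 x := fun x => by unfold gdens; positivity
  have : IsFiniteMeasure (gaussTU d 1 0 0) := by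
    unfold gaussTU
    exact isFiniteMeasure_withDensity_ofReal hint.2
  refine Measure.ext_of_charFun (funext fun w => ?_)
  rw [charFun_stdGaussian, charFun_apply, gaussTU,
    integral_withDensity_eq_integral_toReal_smul₀ hint.aestronglyMeasurable.aemeasurable.ennreal_ofReal
      (Filter.Eventually.of_forall fun x => ENNReal.ofReal_lt_top)]
  have h := GaussianFourier.integral_cexp_neg_mul_sq_norm_add (V := Euc d) (b := (1/2:ℂ))
      (by norm_num) Complex.I w
  have e1 : ∀ x : Euc d, (ENNReal.ofReal (gdens d 1 0 0 x)).toReal • Complex.exp (⟪x, w⟫ * Complex.I)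
     = (((2 * π) ^ (-(d:ℝ)/2) : ℝ) : ℂ) * Complex.exp (-(1 / 2) * ‖x‖ ^ 2 + Complex.I * ⟪w, x⟫) := by
    intro x
    rw [ENNReal.toReal_ofReal (hnn x), Complex.exp_add, Complex.real_smul, gdens]
    push_cast
    rw [real_inner_comm x w]
    simp only [sub_zero]
    ring_nf
  simp_rw [e1]
  rw [integral_const_mul, h]
  have e2 : (π / (1/2) : ℂ) = ((2 * π : ℝ) : ℂ) := by push_cast; ring
  rw [e2, ← mul_assoc, finrank_euclideanSpace_fin, Complex.ofReal_cpow (by positivity),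
    ← Complex.cpow_add _ _ (by simp [Real.pi_ne_zero])]
  have e3 : (((-(d:ℝ)/2 : ℝ) : ℂ) + (d:ℂ)/2) = 0 := by push_cast; ring
  rw [e3, Complex.cpow_zero, one_mul, Complex.I_sq]
  congr 1
  ring

/-- rank one perturbation -/
noncomputable def rk (d : ℕ) (a : ℝ) (u : Euc d) : Euc d →ₗ[ℝ] Euc d :=
  LinearMap.transvection ((innerSL ℝ u : Euc d →L[ℝ] ℝ) : Euc d →ₗ[ℝ] ℝ) ((a - 1) • u)

lemma rk_apply (d : ℕ) (a : ℝ) (u x : Euc d) : rk d a u x = x + (⟪u, x⟫ * (a-1)) • u := by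
  simp [rk, LinearMap.transvection.apply, smul_smul]

lemma rk_det (d : ℕ) (a : ℝ) (u : Euc d) (hu : ‖u‖ = 1) : LinearMap.det (rk d a u) = a := by
  rw [rk, LinearMap.transvection.det]
  simp [hu]

lemma gauss_eq (d : ℕ) (σ : ℝ) (hσ : 0 < σ) (t u : Euc d) (hu : ‖u‖ = 1) :
    gaussTU d σ t u = (stdGaussian (Euc d)).map (fun z => t + rk d σ u z) := by
  have hc : Continuous (rk d σ u) := LinearMap.continuous_of_finiteDimensional _
  have hm : Measurable (fun z => t + rk d σ u z) := (continuous_const.add hc).measurable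
  have hg : ∀ σ t u, Measurable (fun x => ENNReal.ofReal (gdens d σ t u x)) := fun σ t u => by
    unfold gdens; fun_prop
  have hvol : (volume : Measure (Euc d)).map (fun z => t + rk d σ u z)
      = ENNReal.ofReal σ⁻¹ • volume := by
    have : (fun z => t + rk d σ u z) = (fun z => t + z) ∘ (rk d σ u) := rfl
    rw [this, ← Measure.map_map (by fun_prop) hc.measurable,
      Measure.map_linearMap_addHaar_eq_smul_addHaar _ (by rw [rk_det d σ u hu]; exact hσ.ne'),
      rk_det d σ u hu, Measure.map_smul, (measurePreserving_add_left volume t).map_eq,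
      abs_of_pos (inv_pos.2 hσ)]
  rw [← std_eq]
  ext B hB
  rw [Measure.map_apply hm hB, gaussTU, gaussTU, withDensity_apply _ hB, withDensity_apply _ (hm hB)]
  have e1 : ∫⁻ z in (fun z => t + rk d σ u z) ⁻¹' B, ENNReal.ofReal (gdens d σ t u (t + rk d σ u z))
      = ENNReal.ofReal σ⁻¹ * ∫⁻ x in B, ENNReal.ofReal (gdens d σ t u x) := by
    rw [← setLIntegral_map hB (hg σ t u) hm, hvol, Measure.restrict_smul, lintegral_smul_measure]
    rfl
  have e2 : ∀ z, ENNReal.ofReal (gdens d σ t u (t + rk d σ u z))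
      = ENNReal.ofReal σ⁻¹ * ENNReal.ofReal (gdens d 1 0 0 z) := by
    intro z
    rw [← ENNReal.ofReal_mul (by positivity)]
    congr 1
    have h1 : ⟪u, rk d σ u z⟫ = σ * ⟪u, z⟫ := by
      rw [rk_apply, inner_add_right, inner_smul_right, real_inner_self_eq_norm_sq, hu]; ring
    have h2 : ‖rk d σ u z‖^2 = ‖z‖^2 + (σ^2-1) * ⟪u, z⟫^2 := by
      rw [rk_apply, norm_add_sq_real, norm_smul, inner_smul_right, hu, real_inner_comm,
        mul_one, Real.norm_eq_abs, sq_abs, real_inner_comm]; ring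
    simp only [gdens, add_sub_cancel_left, h1, h2, sub_zero]
    have h3 : ‖z‖ ^ 2 + (σ ^ 2 - 1) * ⟪u, z⟫ ^ 2 + ((σ ^ 2)⁻¹ - 1) * (σ * ⟪u, z⟫) ^ 2 = ‖z‖^2 := by
      field_simp; ring
    rw [h3]
    simp
    ring
  simp_rw [e2] at e1
  rw [lintegral_const_mul _ (hg 1 0 0)] at e1
  exact ((ENNReal.mul_right_inj (by simpa using hσ) ENNReal.ofReal_ne_top).1 e1).symm

lemma gauss_prob (d : ℕ) (σ : ℝ) (hσ : 0 < σ) (t u : Euc d) (hu : ‖u‖ = 1) :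
    IsProbabilityMeasure (gaussTU d σ t u) := by
  rw [gauss_eq d σ hσ t u hu]
  have hc : Continuous (rk d σ u) := LinearMap.continuous_of_finiteDimensional _
  exact Measure.isProbabilityMeasure_map (continuous_const.add hc).measurable.aemeasurable

lemma std_marg (d : ℕ) (w : Euc d) :
    (stdGaussian (Euc d)).map (fun z => ⟪w, z⟫) = gaussianReal 0 (‖w‖^2).toNNReal := by
  have h := IsGaussian.map_eq_gaussianReal (μ := stdGaussian (Euc d)) (innerSL ℝ w)
  rw [variance_dual_stdGaussian, integral_strongDual_stdGaussian, innerSL_apply_norm] at h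
  exact h

lemma gauss_marg (d : ℕ) (σ : ℝ) (hσ : 0 < σ) (t s u v : Euc d) (hu : ‖u‖ = 1) (hv : ‖v‖ = 1) :
    (gaussTU d σ t u).map (fun x => ⟪v, x - s⟫)
      = gaussianReal ⟪v, t - s⟫ (1 - (1-σ^2) * ⟪v, u⟫^2).toNNReal := by
  have hc : Continuous (rk d σ u) := LinearMap.continuous_of_finiteDimensional _
  have hm : Measurable (fun z => t + rk d σ u z) := (continuous_const.add hc).measurable
  rw [gauss_eq d σ hσ t u hu, Measure.map_map (by fun_prop) hm]
  have : (fun x => ⟪v, x - s⟫) ∘ (fun z => t + rk d σ u z)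
      = (fun y => ⟪v, t - s⟫ + y) ∘ (fun z => ⟪rk d σ u v, z⟫) := by
    ext z
    simp only [Function.comp, rk_apply, inner_add_right, inner_sub_right, inner_add_left,
      inner_smul_left, inner_smul_right, RCLike.conj_to_real, real_inner_comm v u]
    ring
  rw [this, ← Measure.map_map (by fun_prop) (by fun_prop), std_marg, gaussianReal_map_const_add]
  congr 2
  · ring
  · rw [rk_apply, norm_add_sq_real, norm_smul, inner_smul_right, hu, hv, real_inner_comm,
        mul_one, Real.norm_eq_abs, sq_abs, real_inner_comm]; ring

lemma g_cheb (m : ℝ) (v : NNReal) (c : ℝ) (hc : 0 < c) :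
    (gaussianReal m v).real {y | c ≤ |y - m|} ≤ v / c^2 := by
  have h := meas_ge_le_variance_div_sq (μ := gaussianReal m v) (X := id)
    (memLp_id_gaussianReal 2) hc
  rw [variance_id_gaussianReal] at h
  simp only [id, integral_id_gaussianReal] at h
  exact ENNReal.toReal_le_of_le_ofReal (by positivity) h

lemma g_dens (m : ℝ) (s : ℝ) (hs : 0 < s) (b : ℝ) (hb : 0 ≤ b) :
    (gaussianReal m (s^2).toNNReal).real (Set.Icc (-b) b) ≤ b / s := by
  refine ENNReal.toReal_le_of_le_ofReal (by positivity) ?_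
  have hv : (s^2).toNNReal ≠ 0 := by
    simp only [ne_eq, Real.toNNReal_eq_zero, not_le]; positivity
  rw [gaussianReal_apply _ hv]
  have hle : ∀ x, gaussianPDF m (s^2).toNNReal x ≤ ENNReal.ofReal (1 / (2*s)) := by
    intro x
    refine ENNReal.ofReal_le_ofReal ?_
    rw [gaussianPDFReal, Real.coe_toNNReal _ (by positivity)]
    have h1 : rexp (-(x - m) ^ 2 / (2 * s^2)) ≤ 1 := by
      rw [Real.exp_le_one_iff]
      exact div_nonpos_of_nonpos_of_nonneg (by nlinarith [sq_nonneg (x-m)]) (by positivity)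
    have h2 : 2 * s ≤ √(2 * π * s^2) := by
      apply Real.le_sqrt_of_sq_le
      nlinarith [Real.pi_gt_three, sq_nonneg s]
    have h3 : (√(2 * π * s^2))⁻¹ ≤ 1 / (2*s) := by
      rw [one_div]; exact inv_anti₀ (by positivity) h2
    calc _ ≤ (√(2 * π * s^2))⁻¹ * 1 := by gcongr
      _ ≤ _ := by rwa [mul_one]
  calc _ ≤ ∫⁻ x in Set.Icc (-b) b, ENNReal.ofReal (1 / (2*s)) := lintegral_mono hle
    _ = _ := by
      rw [setLIntegral_const, Real.volume_Icc, ← ENNReal.ofReal_mul (by positivity)]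
      congr 1; field_simp; ring

lemma close_of_tv (d : ℕ) (σ : ℝ) (hσ : 0 < σ) (hσ1 : σ ≤ 1) (t u t' u' : Euc d)
    (hu : ‖u‖ = 1) (hu' : ‖u'‖ = 1)
    (h : tv (gaussTU d σ t u) (gaussTU d σ t' u') ≤ 1/400) :
    1 - ⟪u, u'⟫^2 < 64 * σ^2 ∧ |⟪u, t' - t⟫| < 20 * σ := by
  have := gauss_prob d σ hσ t u hu
  have := gauss_prob d σ hσ t' u' hu'
  have hm : Measurable (fun x : Euc d => ⟪u, x - t⟫) := by fun_prop
  have hI : MeasurableSet (Set.Icc (-(2*σ)) (2*σ)) := measurableSet_Icc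
  have hB := hm hI
  set B := (fun x : Euc d => ⟪u, x - t⟫) ⁻¹' (Set.Icc (-(2*σ)) (2*σ)) with hBdef
  have htv : |(gaussTU d σ t u).real B - (gaussTU d σ t' u').real B| ≤ 1/400 := by
    refine le_trans (le_ciSup (f := fun B : {s : Set (Euc d) // MeasurableSet s} =>
      |((gaussTU d σ t u) B).toReal - ((gaussTU d σ t' u') B).toReal|) ?_ ⟨B, hB⟩) h
    refine ⟨1, ?_⟩
    rintro _ ⟨S, rfl⟩
    have a1 : (gaussTU d σ t u).real S ≤ 1 := measureReal_le_one
    have a2 : (gaussTU d σ t' u').real S ≤ 1 := measureReal_le_one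
    have a3 : 0 ≤ (gaussTU d σ t u).real S := measureReal_nonneg
    have a4 : 0 ≤ (gaussTU d σ t' u').real S := measureReal_nonneg
    change |(gaussTU d σ t u).real S - (gaussTU d σ t' u').real S| ≤ 1
    rw [abs_le]; constructor <;> linarith
  have e1 : (gaussTU d σ t u).real B = (gaussianReal 0 (σ^2).toNNReal).real (Set.Icc (-(2*σ)) (2*σ)) := by
    have := gauss_marg d σ hσ t t u u hu hu
    rw [real_inner_self_eq_norm_sq, hu, sub_self, inner_zero_right] at this
    have e : 1 - (1-σ^2) * (1^2)^2 = σ^2 := by ring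
    rw [e] at this
    rw [← this, Measure.real, Measure.real, Measure.map_apply hm hI]
  have e2 : (gaussTU d σ t' u').real B = (gaussianReal ⟪u, t' - t⟫ (1 - (1-σ^2) * ⟪u, u'⟫^2).toNNReal).real
      (Set.Icc (-(2*σ)) (2*σ)) := by
    rw [← gauss_marg d σ hσ t' t u' u hu' hu, Measure.real, Measure.real, Measure.map_apply hm hI]
  have l1 : 3/4 ≤ (gaussTU d σ t u).real B := by
    rw [e1]
    have c1 := g_cheb 0 (σ^2).toNNReal (2*σ) (by positivity)
    have c2 := probReal_compl_eq_one_sub (μ := gaussianReal 0 (σ^2).toNNReal) hI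
    have c3 : (gaussianReal 0 (σ^2).toNNReal).real (Set.Icc (-(2*σ)) (2*σ))ᶜ
        ≤ (gaussianReal 0 (σ^2).toNNReal).real {y | 2*σ ≤ |y - 0|} := by
      refine measureReal_mono (fun y hy => ?_)
      simp only [Set.mem_compl_iff, Set.mem_Icc, ← abs_le, not_le] at hy
      simpa using hy.le
    rw [Real.coe_toNNReal _ (by positivity)] at c1
    have c4 : σ^2 / (2*σ)^2 = 1/4 := by field_simp; norm_num
    linarith
  have l2 : 1/4 < (gaussTU d σ t' u').real B := by
    have := (abs_le.1 htv).2
    linarith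
  rw [e2] at l2
  have hc : ⟪u, u'⟫^2 ≤ 1 := by
    have := abs_real_inner_le_norm u u'
    rw [hu, hu', mul_one] at this
    rw [← sq_abs]; exact pow_le_one₀ (abs_nonneg _) this
  have hpos : 0 < 1 - (1-σ^2) * ⟪u, u'⟫^2 := by
    have h1 : 0 ≤ 1 - σ^2 := by nlinarith
    nlinarith [sq_pos_of_pos hσ, mul_le_of_le_one_right h1 hc]
  have hs : √(1 - (1-σ^2) * ⟪u, u'⟫^2) < 8 * σ := by
    by_contra hcon
    push Not at hcon
    have hsp := Real.sqrt_pos.2 hpos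
    have := g_dens ⟪u, t' - t⟫ _ hsp (2*σ) (by positivity)
    rw [Real.sq_sqrt hpos.le] at this
    have : 2*σ / √(1 - (1-σ^2) * ⟪u, u'⟫^2) ≤ 1/4 := by
      rw [div_le_iff₀ hsp]; linarith
    linarith
  have hs2 : 1 - (1-σ^2) * ⟪u, u'⟫^2 < 64 * σ^2 := by
    have := (Real.sqrt_lt' (by positivity)).1 hs
    nlinarith
  refine ⟨by nlinarith [sq_nonneg (σ * ⟪u,u'⟫)], ?_⟩
  by_contra hcon
  push Not at hcon
  have c1 := g_cheb ⟪u, t' - t⟫ (1 - (1-σ^2) * ⟪u, u'⟫^2).toNNReal (18*σ) (by positivity)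
  rw [Real.coe_toNNReal _ hpos.le] at c1
  have c3 : (gaussianReal ⟪u, t' - t⟫ (1 - (1-σ^2) * ⟪u, u'⟫^2).toNNReal).real
        (Set.Icc (-(2*σ)) (2*σ)) ≤ (gaussianReal ⟪u, t' - t⟫ (1 - (1-σ^2) * ⟪u, u'⟫^2).toNNReal).real
        {y | 18*σ ≤ |y - ⟪u, t' - t⟫|} := by
    refine measureReal_mono (fun y hy => ?_)
    have hy' := abs_le.2 hy
    have := abs_sub_abs_le_abs_sub ⟪u, t' - t⟫ y
    rw [abs_sub_comm] at this
    simp only [Set.mem_ofPred_eq]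
    linarith
  have c4 : (1 - (1-σ^2) * ⟪u, u'⟫^2) / (18*σ)^2 ≤ 1/4 := by
    rw [div_le_iff₀ (by positivity)]; nlinarith [sq_pos_of_pos hσ]
  linarith

lemma vol_tube (d : ℕ) (hd : 1 ≤ d) (σ : ℝ) (hσ : 0 < σ) (u : Euc d) (hu : ‖u‖ = 1) :
    volume {x : Euc d | ‖x‖ ≤ 1 ∧ ‖x - ⟪u, x⟫ • u‖ ≤ 8 * σ}
      ≤ ENNReal.ofReal (σ^(d-1)) * volume (Metric.closedBall (0 : Euc d) 9) := by
  have hsub : {x : Euc d | ‖x‖ ≤ 1 ∧ ‖x - ⟪u, x⟫ • u‖ ≤ 8 * σ}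
      ⊆ (σ • rk d σ⁻¹ u) '' (Metric.closedBall (0 : Euc d) 9) := by
    rintro x ⟨h1, h2⟩
    refine ⟨⟪u, x⟫ • u + σ⁻¹ • (x - ⟪u, x⟫ • u), ?_, ?_⟩
    · rw [mem_closedBall_zero_iff]
      have a1 : ‖⟪u, x⟫ • u‖ ≤ 1 := by
        rw [norm_smul, hu, mul_one]
        have := norm_inner_le_norm (𝕜 := ℝ) u x
        rw [hu, one_mul] at this
        linarith
      have a2 : ‖σ⁻¹ • (x - ⟪u, x⟫ • u)‖ ≤ 8 := by
        rw [norm_smul, Real.norm_eq_abs, abs_of_pos (inv_pos.2 hσ), inv_mul_le_iff₀ hσ]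
        linarith
      exact (norm_add_le _ _).trans (by linarith)
    · rw [LinearMap.smul_apply, rk_apply]
      simp only [inner_add_right, inner_smul_right, inner_sub_right, real_inner_self_eq_norm_sq, hu]
      simp only [smul_add, smul_sub, smul_smul]
      have : σ * σ⁻¹ = 1 := mul_inv_cancel₀ hσ.ne'
      match_scalars <;> field_simp <;> ring
  refine (measure_mono hsub).trans ?_
  rw [Measure.addHaar_image_linearMap, LinearMap.det_smul, rk_det _ _ _ hu, finrank_euclideanSpace_fin,
    abs_of_pos (by positivity)]
  gcongr
  obtain ⟨n, rfl⟩ : ∃ n, d = n + 1 := ⟨d-1, by omega⟩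
  rw [pow_succ, mul_assoc, mul_inv_cancel₀ hσ.ne']; simp

lemma vol_slab (n : ℕ) (σ : ℝ) (hσ : 0 < σ) (c : ℝ) (w : Euc n) (hw : ‖w‖ = 1) :
    volume {x : Euc n | ‖x‖ ≤ 1/2 ∧ |⟪w, x⟫ - c| ≤ 40 * σ}
      ≤ ENNReal.ofReal σ * volume (Metric.closedBall (0 : Euc n) 41) := by
  have hsub : {x : Euc n | ‖x‖ ≤ 1/2 ∧ |⟪w, x⟫ - c| ≤ 40 * σ}
      ⊆ (fun y => c • w + y) '' (rk n σ w '' (Metric.closedBall (0 : Euc n) 41)) := by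
    rintro x ⟨h1, h2⟩
    refine ⟨x - c • w, ⟨(x - ⟪w, x⟫ • w) + (σ⁻¹ * (⟪w, x⟫ - c)) • w, ?_, ?_⟩, by simp⟩
    · rw [mem_closedBall_zero_iff]
      have a1 : ‖⟪w, x⟫ • w‖ ≤ 1/2 := by
        rw [norm_smul, hw, mul_one]
        have := norm_inner_le_norm (𝕜 := ℝ) w x
        rw [hw, one_mul] at this
        linarith
      have a2 : ‖(σ⁻¹ * (⟪w, x⟫ - c)) • w‖ ≤ 40 := by
        rw [norm_smul, hw, mul_one, Real.norm_eq_abs, abs_mul, abs_of_pos (inv_pos.2 hσ),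
          inv_mul_le_iff₀ hσ]
        linarith
      have a3 := norm_sub_le x (⟪w, x⟫ • w)
      exact (norm_add_le _ _).trans (by linarith)
    · rw [rk_apply]
      simp only [inner_add_right, inner_smul_right, inner_sub_right, real_inner_self_eq_norm_sq, hw]
      match_scalars <;> field_simp <;> ring
  refine (measure_mono hsub).trans ?_
  rw [Set.image_add_left, measure_preimage_add, Measure.addHaar_image_linearMap, rk_det _ _ _ hw,
    abs_of_pos hσ]

lemma normalize_bd {Z : Type*} [MeasurableSpace Z] (μ : Measure Z) :
    ∃ C : ℝ≥0∞, C ≠ ⊤ ∧ ∀ S, normalize μ S ≤ C * μ S := by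
  by_cases h : μ Set.univ = 0
  · refine ⟨0, by simp, fun S => ?_⟩
    rw [Measure.measure_univ_eq_zero] at h
    simp [normalize, h]
  · exact ⟨(μ Set.univ)⁻¹, by simpa using h, fun S => by simp [normalize]⟩

lemma emb_meas (d : ℕ) : Measurable (emb d) := by
  unfold emb
  refine (EuclideanSpace.equiv (Fin d) ℝ).symm.continuous.measurable.comp ?_
  refine measurable_pi_lambda _ fun i => ?_
  split_ifs with h
  · fun_prop
  · fun_prop

lemma emb_inner (d : ℕ) [NeZero d] (hd : 2 ≤ d) (u : Euc d) (hu : u ∈ capN d) :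
    ∃ w : Euc (d-1), (∀ x, ⟪u, emb d x⟫ = ⟪w, x⟫) ∧ 1/2 ≤ ‖w‖ := by
  obtain ⟨n, rfl⟩ : ∃ n, d = n + 1 := ⟨d-1, by omega⟩
  obtain ⟨h1, h2⟩ := hu
  have hl : ⟪u, eLast (n+1)⟫ = u (Fin.last n) := by
    simp only [eLast, EuclideanSpace.inner_single_right]
    simp [lastIdx, Fin.last]
  rw [hl] at h2
  refine ⟨WithLp.toLp 2 (fun i : Fin n => u i.castSucc), fun x => ?_, ?_⟩
  · simp only [PiLp.inner_apply]
    rw [Fin.sum_univ_castSucc]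
    simp [emb]
  · have e : ‖u‖^2 = ‖(WithLp.toLp 2 (fun i : Fin n => u i.castSucc) : Euc n)‖^2 + (u (Fin.last n))^2 := by
      rw [EuclideanSpace.norm_sq_eq, EuclideanSpace.norm_sq_eq, Fin.sum_univ_castSucc]
      simp
    have h3 : (u (Fin.last n))^2 ≤ 3/4 := by
      rw [← sq_abs]
      calc _ ≤ (√3/2)^2 := by gcongr
        _ = 3/4 := by rw [div_pow, Real.sq_sqrt (by norm_num)]; norm_num
    rw [h1] at e
    change 1/2 ≤ ‖(WithLp.toLp 2 (fun i : Fin n => u i.castSucc) : Euc n)‖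
    nlinarith [norm_nonneg (WithLp.toLp 2 (fun i : Fin n => u i.castSucc) : Euc n)]

lemma uT_bd (d : ℕ) [NeZero d] (hd : 2 ≤ d) : ∃ C : ℝ≥0∞, C ≠ ⊤ ∧ ∀ σ : ℝ, 0 < σ → ∀ t u : Euc d,
    u ∈ capN d → uniformT d {t' | |⟪u, t' - t⟫| < 20 * σ} ≤ C * ENNReal.ofReal σ := by
  obtain ⟨C, hC, h⟩ := normalize_bd ((volume.restrict {x : Euc (d-1) | ‖x‖ ≤ 1/2}).map (emb d))
  refine ⟨C * volume (Metric.closedBall (0 : Euc (d-1)) 41),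
    ENNReal.mul_ne_top hC measure_closedBall_lt_top.ne, fun σ hσ t u hu => ?_⟩
  refine (h _).trans ?_
  obtain ⟨w, hw, hw2⟩ := emb_inner d hd u hu
  have hwp : 0 < ‖w‖ := by linarith
  have hS : MeasurableSet {t' : Euc d | |⟪u, t' - t⟫| < 20 * σ} :=
    measurableSet_lt (by fun_prop) (by fun_prop)
  rw [Measure.map_apply (emb_meas d) hS, Measure.restrict_apply (emb_meas d hS), mul_assoc,
    mul_comm (volume _) (ENNReal.ofReal σ)]
  gcongr
  refine le_trans (measure_mono ?_) (vol_slab (d-1) σ hσ (‖w‖⁻¹ * ⟪u, t⟫) (‖w‖⁻¹ • w) ?_)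
  · rintro x ⟨hx1, hx2⟩
    refine ⟨hx2, ?_⟩
    have hx1 : |⟪u, emb d x - t⟫| < 20 * σ := hx1
    rw [inner_sub_right, hw] at hx1
    rw [inner_smul_left, RCLike.conj_to_real, ← mul_sub, abs_mul, abs_of_pos (inv_pos.2 hwp),
      inv_mul_le_iff₀ hwp]
    nlinarith
  · rw [norm_smul, norm_inv, norm_norm, inv_mul_cancel₀ hwp.ne']

lemma nrm_meas (d : ℕ) : Measurable (fun x : Euc d => ‖x‖⁻¹ • x) := by fun_prop

lemma uN_bd (d : ℕ) [NeZero d] (hd : 2 ≤ d) : ∃ C : ℝ≥0∞, C ≠ ⊤ ∧ ∀ σ : ℝ, 0 < σ → ∀ u : Euc d,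
    ‖u‖ = 1 → uniformN d {v | ‖v‖ = 1 → 1 - ⟪u, v⟫^2 < 64 * σ^2} ≤ C * ENNReal.ofReal (σ^(d-1)) := by
  obtain ⟨C, hC, h⟩ := normalize_bd ((volume.restrict
      {x : Euc d | 0 < ‖x‖ ∧ ‖x‖ ≤ 1 ∧ ‖x‖⁻¹ • x ∈ capN d}).map (fun x => ‖x‖⁻¹ • x))
  refine ⟨C * volume (Metric.closedBall (0 : Euc d) 9),
    ENNReal.mul_ne_top hC measure_closedBall_lt_top.ne, fun σ hσ u hu => ?_⟩
  refine (h _).trans ?_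
  have hS : MeasurableSet {v : Euc d | ‖v‖ = 1 → 1 - ⟪u, v⟫^2 < 64 * σ^2} := by
    have h1 : MeasurableSet {v : Euc d | ‖v‖ = 1} := measurableSet_eq_fun (by fun_prop) (by fun_prop)
    have h2 : MeasurableSet {v : Euc d | 1 - ⟪u, v⟫^2 < 64 * σ^2} :=
      measurableSet_lt (by fun_prop) (by fun_prop)
    exact h1.imp h2
  rw [Measure.map_apply (nrm_meas d) hS, Measure.restrict_apply (nrm_meas d hS), mul_assoc,
    mul_comm (volume _) (ENNReal.ofReal _)]
  gcongr
  refine le_trans (measure_mono ?_) (vol_tube d (by omega) σ hσ u hu)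
  rintro x ⟨hx1, hx2, hx3, hx4⟩
  refine ⟨hx3, ?_⟩
  have hx1 : 1 - ⟪u, ‖x‖⁻¹ • x⟫^2 < 64 * σ^2 := hx1 hx4.1
  rw [inner_smul_right] at hx1
  have e : ‖x - ⟪u, x⟫ • u‖^2 = ‖x‖^2 * (1 - (‖x‖⁻¹ * ⟪u, x⟫)^2) := by
    rw [norm_sub_sq_real, norm_smul, inner_smul_right, hu, mul_one, Real.norm_eq_abs, sq_abs,
      real_inner_comm]
    field_simp
    ring
  have h8 : ‖x - ⟪u, x⟫ • u‖^2 ≤ (8 * σ)^2 := by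
    rw [e]
    have : ‖x‖^2 ≤ 1 := pow_le_one₀ hx2.le hx3
    nlinarith [sq_nonneg σ, sq_nonneg ‖x‖]
  exact abs_le_of_sq_le_sq' h8 (by positivity) |>.2

lemma uN_supp (d : ℕ) [NeZero d] : uniformN d {v | ‖v‖ ≠ 1} = 0 := by
  obtain ⟨C, hC, h⟩ := normalize_bd ((volume.restrict
      {x : Euc d | 0 < ‖x‖ ∧ ‖x‖ ≤ 1 ∧ ‖x‖⁻¹ • x ∈ capN d}).map (fun x => ‖x‖⁻¹ • x))
  have h1 : MeasurableSet {v : Euc d | ‖v‖ ≠ 1} :=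
    (measurableSet_eq_fun (f := fun v : Euc d => ‖v‖) (by fun_prop) (measurable_const (a := (1:ℝ)))).compl
  have h0 := h {v | ‖v‖ ≠ 1}
  rw [Measure.map_apply (nrm_meas d) h1, Measure.restrict_apply (nrm_meas d h1)] at h0
  have : ((fun x : Euc d => ‖x‖⁻¹ • x) ⁻¹' {v | ‖v‖ ≠ 1}) ∩
      {x : Euc d | 0 < ‖x‖ ∧ ‖x‖ ≤ 1 ∧ ‖x‖⁻¹ • x ∈ capN d} = ∅ := by
    ext x
    simp only [Set.mem_inter_iff, Set.mem_empty_iff_false, iff_false]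
    rintro ⟨a, -, -, b⟩
    exact a b.1
  rw [this, measure_empty, mul_zero] at h0
  exact le_antisymm h0 zero_le'

instance sfT (d : ℕ) : SFinite (uniformT d) := by unfold uniformT normalize; infer_instance
instance sfN (d : ℕ) [NeZero d] : SFinite (uniformN d) := by unfold uniformN normalize; infer_instance

/-- **Claim 6.4**: for `d ≥ 2`, there is a constant `C_d > 0` such that for every `k ≥ 1`
and every `(t,u) ∈ T × N`, the probability over a uniform `(t',u') ∈ T × N` that
`tv(G(1/k,t,u), G(1/k,t',u')) ≤ 1/400` is at most `C_d / k^d`; in particular,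
`r_k = sup_{(t,u)} P(tv ≤ 1/400) = O(1/k^d) → 0`. -/
theorem tv_ball_mass_small (d : ℕ) [NeZero d] (hd : 2 ≤ d) :
    ∃ Cd : ℝ, 0 < Cd ∧ ∀ k : ℕ, 1 ≤ k → ∀ t u : Euc d, t ∈ diskT d → u ∈ capN d →
      uniformTN d {z | tv (gaussTU d (1/(k:ℝ)) t u) (gaussTU d (1/(k:ℝ)) z.1 z.2) ≤ 1/400}
        ≤ ENNReal.ofReal (Cd / (k:ℝ)^d) := by


  obtain ⟨C1, h1t, h1⟩ := uT_bd d hd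
  obtain ⟨C2, h2t, h2⟩ := uN_bd d hd
  refine ⟨(C1 * C2).toReal + 1, by positivity, fun k hk t u ht hu => ?_⟩
  have hk0 : (0:ℝ) < k := by exact_mod_cast hk
  have hσ : 0 < 1/(k:ℝ) := by positivity
  have hσ1 : 1/(k:ℝ) ≤ 1 := by
    rw [div_le_one hk0]; exact_mod_cast hk
  set σ := 1/(k:ℝ) with hs
  have hsub : {z : Euc d × Euc d | tv (gaussTU d σ t u) (gaussTU d σ z.1 z.2) ≤ 1/400}
      ⊆ ({t' | |⟪u, t' - t⟫| < 20 * σ} ×ˢ {v | ‖v‖ = 1 → 1 - ⟪u, v⟫^2 < 64 * σ^2})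
        ∪ (Set.univ ×ˢ {v | ‖v‖ ≠ 1}) := by
    rintro ⟨t', v⟩ hz
    by_cases hv : ‖v‖ = 1
    · left
      have := close_of_tv d σ hσ hσ1 t u t' v hu.1 hv hz
      exact ⟨this.2, fun _ => this.1⟩
    · right
      exact ⟨trivial, hv⟩
  refine (measure_mono hsub).trans ((measure_union_le _ _).trans ?_)
  rw [uniformTN, Measure.prod_prod, Measure.prod_prod, uN_supp, mul_zero, add_zero]
  calc _ ≤ (C1 * ENNReal.ofReal σ) * (C2 * ENNReal.ofReal (σ^(d-1))) :=
        mul_le_mul' (h1 σ hσ t u hu) (h2 σ hσ u hu.1)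
    _ = (C1 * C2) * ENNReal.ofReal (σ^d) := by
        have : σ^d = σ * σ^(d-1) := by rw [← pow_succ']; congr 1; omega
        rw [this, ENNReal.ofReal_mul hσ.le]; ring
    _ = ENNReal.ofReal ((C1 * C2).toReal * σ^d) := by
        rw [ENNReal.ofReal_mul ENNReal.toReal_nonneg,
          ENNReal.ofReal_toReal (ENNReal.mul_ne_top h1t h2t)]
    _ ≤ _ := by
        refine ENNReal.ofReal_le_ofReal ?_
        rw [hs, div_pow, one_pow, mul_one_div]
        gcongr
        linarith

end GaussLB
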